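/- Let N ≥ 2, let G be a connected simple graph on the vertex set Fin N, let Z₀ > 0 be real, and let u, h ∈ ℂ^N with ‖u‖ = 1 and ‖h‖ = 1. Assume that for every edge {n,m} of G the complex numbers i·Z₀·(u_n + h_n) and i·Z₀·(u_m + h_m) are ℝ-linearly independent. Then there exists a real symmetric N×N matrix B supported on G such that the complex matrix I + i·Z₀·B is invertible and (I + i·Z₀·B)⁻¹·(I − i·Z₀·B)·u = h. -/

import Mathlib

/-- A real matrix `B` is *supported on* a simple graph `G` on `Fin N` if every
off-diagonal entry corresponding to a non-edge of `G` vanishes. -/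
def SupportedOn {N : ℕ} (G : SimpleGraph (Fin N)) (B : Matrix (Fin N) (Fin N) ℝ) : Prop :=
  ∀ n m, n ≠ m → ¬ G.Adj n m → B n m = 0

/-- Existence of a flow on a connected graph between two vertices. -/
lemma flow_walk {N : ℕ} (G : SimpleGraph (Fin N)) {a b : Fin N} (p : G.Walk a b) :
    ∃ f : Fin N → Fin N → ℝ, (∀ n m, f n m = - f m n) ∧ (∀ n m, ¬ G.Adj n m → f n m = 0) ∧
      ∀ n, ∑ m, f n m = (if n = a then 1 else 0) - (if n = b then 1 else 0) := by
  induction p with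
  | nil => exact ⟨fun _ _ => 0, by simp, by simp, by simp⟩
  | @cons a v b hadj p ih =>
    obtain ⟨f, h1, h2, h3⟩ := ih
    refine ⟨fun n m => f n m + ((if n = a then 1 else 0) * (if m = v then 1 else 0)
      - (if n = v then 1 else 0) * (if m = a then 1 else 0)), ?_, ?_, ?_⟩
    · intro n m
      simp only [h1 n m]
      ring
    · intro n m hnm
      have e1 : ¬ (n = a ∧ m = v) := by
        rintro ⟨rfl, rfl⟩
        exact hnm hadj
      have e2 : ¬ (n = v ∧ m = a) := by
        rintro ⟨rfl, rfl⟩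
        exact hnm hadj.symm
      simp only [h2 n m hnm]
      clear h1 h2 h3
      by_cases q1 : n = a <;> by_cases q2 : m = v <;> by_cases q3 : n = v <;>
        by_cases q4 : m = a <;> simp_all
    · intro n
      simp only [Finset.sum_add_distrib, h3, Finset.sum_sub_distrib, ← Finset.mul_sum]
      simp

lemma flow_exists {N : ℕ} (G : SimpleGraph (Fin N)) (hG : G.Connected) (c : Fin N → ℝ)
    (hc : ∑ n, c n = 0) :
    ∃ f : Fin N → Fin N → ℝ, (∀ n m, f n m = - f m n) ∧ (∀ n m, ¬ G.Adj n m → f n m = 0) ∧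
      ∀ n, ∑ m, f n m = c n := by
  obtain ⟨r⟩ := hG.nonempty
  have H : ∀ a, ∃ f : Fin N → Fin N → ℝ, (∀ n m, f n m = - f m n) ∧
      (∀ n m, ¬ G.Adj n m → f n m = 0) ∧
      ∀ n, ∑ m, f n m = (if n = a then 1 else 0) - (if n = r then 1 else 0) := fun a =>
    flow_walk G (hG.preconnected a r).some
  choose f h1 h2 h3 using H
  refine ⟨fun n m => ∑ a, c a * f a n m, ?_, ?_, ?_⟩
  · intro n m
    rw [← Finset.sum_neg_distrib]
    exact Finset.sum_congr rfl fun a _ => by rw [h1 a n m]; ring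
  · intro n m hnm
    exact Finset.sum_eq_zero fun a _ => by rw [h2 a n m hnm, mul_zero]
  · intro n
    rw [Finset.sum_comm]
    simp only [← Finset.mul_sum, h3, mul_sub, Finset.sum_sub_distrib, ← Finset.sum_mul, hc]
    simp

open ComplexConjugate in
lemma im_ne_zero_of_indep (z w : ℂ) (hzw : LinearIndependent ℝ ![z, w]) :
    (conj z * w).im ≠ 0 := by
  intro him
  have hz : z ≠ 0 := hzw.ne_zero 0
  have := (LinearIndependent.pair_iff.1 hzw (conj z * w).re (-Complex.normSq z) (by
    have e : (((conj z * w).re : ℝ) : ℂ) = conj z * w := by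
      apply Complex.ext
      · simp
      · rw [him]; simp
    rw [Complex.real_smul, Complex.real_smul, e, Complex.ofReal_neg, Complex.normSq_eq_conj_mul_self]
    ring)).2
  exact hz (Complex.normSq_eq_zero.1 (neg_eq_zero.1 this))

open ComplexConjugate in
lemma tree_system {N : ℕ} (hN : 2 ≤ N) (G : SimpleGraph (Fin N)) (hG : G.Connected)
    (α β : Fin N → ℂ) (hα : ∀ n m, G.Adj n m → LinearIndependent ℝ ![α n, α m])
    (hs : ∑ n, (conj (α n) * β n).im = 0) :
    ∃ B : Matrix (Fin N) (Fin N) ℝ, B.IsSymm ∧ SupportedOn G B ∧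
      (B.map Complex.ofReal).mulVec α = β := by
  have hne : ∀ n, α n ≠ 0 := by
    intro n
    have : Nontrivial (Fin N) := Fin.nontrivial_iff_two_le.2 hN
    obtain ⟨m, hm⟩ := exists_ne n
    obtain ⟨p⟩ := hG.preconnected n m
    cases p with
    | nil => exact absurd rfl hm
    | cons hadj _ => exact (hα _ _ hadj).ne_zero 0
  obtain ⟨f, h1, h2, h3⟩ := flow_exists G hG _ hs
  let K : Fin N → Fin N → ℝ := fun n m => (conj (α n) * α m).im
  have hK : ∀ n m, K n m = - K m n := by
    intro n m
    simp only [K, Complex.mul_im, Complex.conj_re, Complex.conj_im]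
    ring
  let O : Fin N → Fin N → ℝ := fun n m => f n m / K n m
  have hO0 : ∀ n m, ¬ G.Adj n m → O n m = 0 := fun n m hnm => by simp [O, h2 n m hnm]
  have hOK : ∀ n m, O n m * K n m = f n m := by
    intro n m
    by_cases hnm : G.Adj n m
    · exact div_mul_cancel₀ _ (im_ne_zero_of_indep _ _ (hα n m hnm))
    · rw [hO0 n m hnm, h2 n m hnm, zero_mul]
  let d : Fin N → ℂ := fun n => β n - ∑ m, (O n m : ℂ) * α m
  have hd : ∀ n, (conj (α n) * d n).im = 0 := by
    intro n
    have : (conj (α n) * ∑ m, (O n m : ℂ) * α m).im = ∑ m, f n m := by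
      rw [Finset.mul_sum, Complex.im_sum]
      refine Finset.sum_congr rfl fun m _ => ?_
      rw [← hOK, mul_left_comm, Complex.im_ofReal_mul]
    simp only [d]
    rw [mul_sub, Complex.sub_im, this, h3, sub_self]
  let g : Fin N → ℝ := fun n => (conj (α n) * d n).re / Complex.normSq (α n)
  have hg : ∀ n, (g n : ℂ) * α n = d n := by
    intro n
    have e : (((conj (α n) * d n).re : ℝ) : ℂ) = conj (α n) * d n := by
      apply Complex.ext
      · simp
      · rw [hd]; simp
    have hc : conj (α n) ≠ 0 := (map_ne_zero _).2 (hne n)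
    have hn := hne n
    simp only [g]
    rw [Complex.ofReal_div, e, Complex.normSq_eq_conj_mul_self]
    field_simp
  refine ⟨Matrix.of O + Matrix.diagonal g, ?_, ?_, ?_⟩
  · apply Matrix.IsSymm.add
    · ext n m
      simp only [Matrix.transpose_apply, Matrix.of_apply, O]
      rw [h1, hK, neg_div_neg_eq]
    · exact Matrix.isSymm_diagonal g
  · intro n m hnm hadj
    simp [hO0 n m hadj, Matrix.diagonal_apply_ne _ hnm]
  · ext n
    have : ((Matrix.of O + Matrix.diagonal g).map Complex.ofReal) =
        (Matrix.of fun n m => (O n m : ℂ)) + Matrix.diagonal fun n => (g n : ℂ) := by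
      ext i j
      by_cases hij : i = j
      · subst hij; simp
      · simp [Matrix.diagonal_apply_ne _ hij]
    rw [this, Matrix.add_mulVec, Pi.add_apply, Matrix.mulVec_diagonal, hg]
    simp [Matrix.mulVec, dotProduct, d]

open scoped ComplexOrder in
lemma isUnit_one_add {N : ℕ} (Z₀ : ℝ) (B : Matrix (Fin N) (Fin N) ℝ) (hB : B.IsSymm) :
    IsUnit ((1 : Matrix (Fin N) (Fin N) ℂ) + (Complex.I * Z₀) • B.map Complex.ofReal) := by
  set A : Matrix (Fin N) (Fin N) ℂ := (Complex.I * Z₀) • B.map Complex.ofReal with hA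
  have hAH : A.conjTranspose = -A := by
    ext i j
    simp [hA, Matrix.conjTranspose_apply, hB.apply i j]
  have hpd : ((1 : Matrix (Fin N) (Fin N) ℂ) + A * A.conjTranspose).PosDef :=
    Matrix.PosDef.one.add_posSemidef (Matrix.posSemidef_self_mul_conjTranspose A)
  have e : (1 : Matrix (Fin N) (Fin N) ℂ) + A * A.conjTranspose = (1 + A) * (1 - A) := by
    rw [hAH]; noncomm_ring
  have hu := hpd.isUnit
  rw [e, Matrix.isUnit_iff_isUnit_det, Matrix.det_mul] at hu
  exact (Matrix.isUnit_iff_isUnit_det _).2 (isUnit_of_mul_isUnit_left hu)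

/-- For a connected simple graph `G` on `Fin N` (`N ≥ 2`),
`Z₀ > 0`, and unit vectors `u, h ∈ ℂ^N` such that for every edge `{n,m}` of `G`
the numbers `i Z₀ (u n + h n)` and `i Z₀ (u m + h m)` are `ℝ`-linearly
independent, there exists a real symmetric matrix `B` supported on `G` such that
`I + i Z₀ B` is invertible and `(I + i Z₀ B)⁻¹ (I − i Z₀ B) u = h`. -/
theorem connected_scattering_exists {N : ℕ} (hN : 2 ≤ N) (G : SimpleGraph (Fin N))
    (hG : G.Connected) (Z₀ : ℝ) (hZ : 0 < Z₀) (u h : EuclideanSpace ℂ (Fin N))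
    (hu : ‖u‖ = 1) (hh : ‖h‖ = 1)
    (hα : ∀ n m, G.Adj n m →
      LinearIndependent ℝ ![Complex.I * Z₀ * (u n + h n), Complex.I * Z₀ * (u m + h m)]) :
    ∃ B : Matrix (Fin N) (Fin N) ℝ, B.IsSymm ∧ SupportedOn G B ∧
      IsUnit ((1 : Matrix (Fin N) (Fin N) ℂ) + (Complex.I * Z₀) • B.map Complex.ofReal) ∧
      (((1 : Matrix (Fin N) (Fin N) ℂ) + (Complex.I * Z₀) • B.map Complex.ofReal)⁻¹ *
          ((1 : Matrix (Fin N) (Fin N) ℂ) - (Complex.I * Z₀) • B.map Complex.ofReal)).mulVec u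
        = fun n => h n := by
  obtain ⟨B, hB, hS, hBα⟩ := tree_system hN G hG
    (fun n => Complex.I * Z₀ * (u n + h n)) (fun n => u n - h n) hα (by
      have e : ∀ v : EuclideanSpace ℂ (Fin N), ‖v‖ = 1 → ∑ n, Complex.normSq (v n) = 1 := by
        intro v hv
        have := EuclideanSpace.norm_sq_eq v
        rw [hv] at this
        simp only [Complex.normSq_eq_norm_sq]
        linarith
      have : ∀ n, ((starRingEnd ℂ) (Complex.I * Z₀ * (u n + h n)) * (u n - h n)).im =
          -Z₀ * (Complex.normSq (u n) - Complex.normSq (h n)) := by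
        intro n
        simp [Complex.normSq_apply]
        ring
      simp only [this, ← Finset.mul_sum, Finset.sum_sub_distrib, e u hu, e h hh]
      simp)
  have hU := isUnit_one_add Z₀ B hB
  refine ⟨B, hB, hS, hU, ?_⟩
  set A : Matrix (Fin N) (Fin N) ℂ := (Complex.I * Z₀) • B.map Complex.ofReal with hA
  have key : A.mulVec u + A.mulVec h = fun n => u n - h n := by
    rw [← hBα, hA, ← Matrix.mulVec_add, Matrix.smul_mulVec, ← Matrix.mulVec_smul]
    rfl
  have h2 : ((1 : Matrix (Fin N) (Fin N) ℂ) - A).mulVec u = (1 + A).mulVec (fun n => h n) := by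
    rw [Matrix.sub_mulVec, Matrix.add_mulVec, Matrix.one_mulVec, Matrix.one_mulVec]
    ext n
    have := congrFun key n
    simp only [Pi.add_apply, Pi.sub_apply] at this ⊢
    linear_combination -this
  rw [← Matrix.mulVec_mulVec, h2, Matrix.mulVec_mulVec,
    Matrix.nonsing_inv_mul _ ((Matrix.isUnit_iff_isUnit_det _).1 hU), Matrix.one_mulVec]
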